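/- For every integer Q ≥ 1 and every n ∈ 𝔽_q[t], δ(n) = q^{−2Q}·∑_{r monic, |r| ≤ q^Q} ∑_{a ∈ 𝔽_q[t], |a| < |r|, gcd(a,r)=1} ψ(a·n/r)·h(r/t^Q, n/t^{2Q}), where δ(0) = 1 and δ(n) = 0 for n ≠ 0, and ψ(an/r) means ψ applied to the Laurent expansion at infinity of the rational function an/r. Moreover, for each such r, q^{−2Q}·h(r/t^Q, n/t^{2Q}) = ∫_{|α| < |r|^{−1}·q^{−Q}} ψ(α·n) dμ(α). -/

import Mathlib

open Polynomial MeasureTheory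
open scoped Classical

noncomputable section

variable (Fq : Type) [Field Fq] [Fintype Fq]

/-- `K_∞ = 𝔽_q((1/t))`, encoded as formal Laurent series in `X = t⁻¹`;
the coefficient of `t^{-i}` of `α` is `α.coeff i`. -/
abbrev Kinf := LaurentSeries Fq

/-- The element `t ∈ K_∞` (i.e. `X⁻¹`). -/
def tK : Kinf Fq := HahnSeries.single (-1 : ℤ) 1

/-- The embedding `𝔽_q[t] → K_∞` sending `t` to `tK`. -/
def polyToK : Polynomial Fq →+* Kinf Fq := Polynomial.eval₂RingHom HahnSeries.C (tK Fq)

/-- The absolute value at infinity on `K_∞`: `|α| = q^{deg α}`, `|0| = 0`. -/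
def absK (α : Kinf Fq) : ℝ :=
  if α = 0 then 0 else (Fintype.card Fq : ℝ) ^ (-(HahnSeries.order α))

/-- The additive character `e_q(a) = exp(2πi·tr(a)/p)` of `𝔽_q`. -/
def eFq (a : Fq) : ℂ :=
  letI : Algebra (ZMod (ringChar Fq)) Fq := ZMod.algebra _ _
  Complex.exp (2 * Real.pi * Complex.I *
    (((ZMod.val (Algebra.trace (ZMod (ringChar Fq)) Fq a)) : ℂ) / (ringChar Fq : ℂ)))

/-- The additive character `ψ : K_∞ → ℂ`, `ψ(α) = e_q(a_{-1})`. -/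
def psiK (α : Kinf Fq) : ℂ := eFq Fq (α.coeff 1)

/-- The Borel σ-algebra of `K_∞`, generated by the metric balls. -/
def KinfMS : MeasurableSpace (Kinf Fq) :=
  MeasurableSpace.generateFrom
    {s : Set (Kinf Fq) | ∃ (a : Kinf Fq) (n : ℤ),
      s = {x | absK Fq (x - a) < (Fintype.card Fq : ℝ) ^ n}}

/-- `μ` is the additive Haar measure on `K_∞` normalized by `μ(𝕋) = 1`:
it is translation invariant and gives the unit ball measure `1`. -/
def IsHaar (μ : @Measure (Kinf Fq) (KinfMS Fq)) : Prop :=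
  (∀ (a : Kinf Fq) (s : Set (Kinf Fq)), μ ((a + ·) ⁻¹' s) = μ s) ∧
    μ {x : Kinf Fq | absK Fq x < 1} = 1

end

noncomputable section

variable (Fq : Type) [Field Fq] [Fintype Fq]

/-- The set of polynomials `b` with `|b| < q^d`, i.e. of degree `< d`. -/
def polysLT (d : ℕ) : Finset (Polynomial Fq) :=
  (Finset.univ : Finset (Fin d → Fq)).image fun c =>
    ∑ i : Fin d, Polynomial.C (c i) * Polynomial.X ^ (i : ℕ)

/-- Representatives `a` with `|a| < |r|` and `gcd(a,r) = 1`. -/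
def coprimeReps (r : Polynomial Fq) : Finset (Polynomial Fq) :=
  (polysLT Fq r.natDegree).filter fun x => IsCoprime x r

/-- The weight `h(x,y) = |x|⁻¹` if `|y| < |x|`, and `0` otherwise. -/
def hwt (x y : Kinf Fq) : ℝ := if absK Fq y < absK Fq x then (absK Fq x)⁻¹ else 0

set_option linter.unusedSectionVars false

/-! ### The additive character -/

lemma eFq_zero : eFq Fq 0 = 1 := by
  simp [eFq]

lemma eFq_eq_stdAddChar (a : Fq) :
    letI : Algebra (ZMod (ringChar Fq)) Fq := ZMod.algebra _ _
    haveI : NeZero (ringChar Fq) := ⟨CharP.ringChar_ne_zero_of_finite Fq⟩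
    eFq Fq a = ZMod.stdAddChar (Algebra.trace (ZMod (ringChar Fq)) Fq a) := by
  have : NeZero (ringChar Fq) := ⟨CharP.ringChar_ne_zero_of_finite Fq⟩
  rw [ZMod.stdAddChar_apply, ZMod.toCircle_apply, eFq]
  congr 1
  ring

lemma eFq_add (a b : Fq) : eFq Fq (a + b) = eFq Fq a * eFq Fq b := by
  simp only [eFq_eq_stdAddChar, map_add, AddChar.map_add_eq_mul]

lemma exists_eFq_ne_one : ∃ a : Fq, eFq Fq a ≠ 1 := by
  let _ : Algebra (ZMod (ringChar Fq)) Fq := ZMod.algebra _ _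
  have : NeZero (ringChar Fq) := ⟨CharP.ringChar_ne_zero_of_finite Fq⟩
  have : Fact (ringChar Fq).Prime := ⟨CharP.char_is_prime Fq _⟩
  obtain ⟨a, ha⟩ := FiniteField.trace_to_zmod_nondegenerate Fq (one_ne_zero (α := Fq))
  refine ⟨a, fun h => ha ?_⟩
  rw [eFq_eq_stdAddChar, ← AddChar.map_zero_eq_one (ZMod.stdAddChar (N := ringChar Fq))] at h
  simpa using ZMod.injective_stdAddChar h

lemma psiK_add (x y : Kinf Fq) : psiK Fq (x + y) = psiK Fq x * psiK Fq y := by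
  simp [psiK, eFq_add]

lemma exists_psiK_single_mul_ne_one {x : Kinf Fq} {i : ℤ} (hx : x.coeff (1 - i) ≠ 0) :
    ∃ c : Fq, psiK Fq (HahnSeries.single i c * x) ≠ 1 := by
  obtain ⟨a, ha⟩ := exists_eFq_ne_one Fq
  refine ⟨a / x.coeff (1 - i), ?_⟩
  rwa [psiK, HahnSeries.coeff_single_mul, div_mul_cancel₀ _ hx]

/-! ### Polynomials in `K_∞` and the absolute value -/

lemma polyToK_C_mul_X_pow (c : Fq) (k : ℕ) :
    polyToK Fq (C c * X ^ k) = HahnSeries.single (-(k : ℤ)) c := by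
  simp [polyToK, tK, HahnSeries.C_apply, HahnSeries.single_pow, HahnSeries.single_mul_single]

lemma coeff_polyToK (p : Polynomial Fq) (i : ℤ) :
    (polyToK Fq p).coeff i = if i ≤ 0 then p.coeff (-i).toNat else 0 := by
  induction p using Polynomial.induction_on' with
  | add p q hp hq =>
    rw [map_add, HahnSeries.coeff_add, hp, hq]
    split_ifs <;> simp
  | monomial k c =>
    rw [← C_mul_X_pow_eq_monomial, polyToK_C_mul_X_pow, HahnSeries.coeff_single, coeff_C_mul,
      coeff_X_pow]
    split_ifs <;> first | omega | simp

lemma polyToK_ne_zero {p : Polynomial Fq} (hp : p ≠ 0) : polyToK Fq p ≠ 0 := by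
  intro h
  have := coeff_polyToK Fq p (-(p.natDegree : ℤ))
  simp [h] at this
  exact hp (leadingCoeff_eq_zero.1 this.symm)

lemma psiK_polyToK (p : Polynomial Fq) : psiK Fq (polyToK Fq p) = 1 := by
  simp [psiK, coeff_polyToK, eFq_zero]

lemma order_polyToK {p : Polynomial Fq} (hp : p ≠ 0) :
    (polyToK Fq p).order = -(p.natDegree : ℤ) := by
  refine le_antisymm (HahnSeries.order_le_of_coeff_ne_zero ?_)
    ((HahnSeries.le_order_iff_forall (polyToK_ne_zero Fq hp)).2 fun j hj => ?_)
  · simpa [coeff_polyToK] using hp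
  · rw [coeff_polyToK]
    split_ifs
    · exact coeff_eq_zero_of_natDegree_lt (by omega)
    · rfl

lemma one_lt_card_real : (1 : ℝ) < Fintype.card Fq := by
  exact_mod_cast Fintype.one_lt_card

lemma absK_mul (x y : Kinf Fq) : absK Fq (x * y) = absK Fq x * absK Fq y := by
  by_cases hx : x = 0
  · simp [absK, hx]
  by_cases hy : y = 0
  · simp [absK, hy]
  have hq : (Fintype.card Fq : ℝ) ≠ 0 := by simp
  rw [absK, absK, absK, if_neg (mul_ne_zero hx hy), if_neg hx, if_neg hy,
    HahnSeries.order_mul hx hy, ← zpow_add₀ hq]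
  congr 1
  ring

lemma absK_one : absK Fq 1 = 1 := by
  simp [absK]

lemma absK_tK_pow (k : ℕ) : absK Fq (tK Fq ^ k) = (Fintype.card Fq : ℝ) ^ k := by
  have h : absK Fq (tK Fq) = Fintype.card Fq := by
    simp [absK, tK, HahnSeries.order_single (one_ne_zero (α := Fq))]
  induction k with
  | zero => simp [absK_one]
  | succ k ih => rw [pow_succ, absK_mul, ih, h, pow_succ]

lemma absK_polyToK {p : Polynomial Fq} (hp : p ≠ 0) :
    absK Fq (polyToK Fq p) = (Fintype.card Fq : ℝ) ^ p.natDegree := by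
  rw [absK, if_neg (polyToK_ne_zero Fq hp), order_polyToK Fq hp, neg_neg, zpow_natCast]

lemma absK_div_tK_pow (x : Kinf Fq) (k : ℕ) :
    absK Fq (x / tK Fq ^ k) = absK Fq x / (Fintype.card Fq : ℝ) ^ k := by
  have ht : tK Fq ^ k ≠ 0 := pow_ne_zero _ (by simp [tK])
  have hq : (Fintype.card Fq : ℝ) ^ k ≠ 0 := by simp
  rw [eq_div_iff hq, ← absK_tK_pow, ← absK_mul, div_mul_cancel₀ _ ht]

lemma hwt_eq {r : Polynomial Fq} (hr : r ≠ 0) (n : Polynomial Fq) (Q : ℕ) :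
    hwt Fq (polyToK Fq r / tK Fq ^ Q) (polyToK Fq n / tK Fq ^ (2 * Q)) =
      if n = 0 ∨ n.natDegree < r.natDegree + Q then
        (Fintype.card Fq : ℝ) ^ Q / (Fintype.card Fq : ℝ) ^ r.natDegree else 0 := by
  have hq := one_lt_card_real Fq
  have hq0 : (0 : ℝ) < Fintype.card Fq := by linarith
  rw [hwt, absK_div_tK_pow, absK_div_tK_pow, absK_polyToK Fq hr, inv_div]
  by_cases hn : n = 0
  · have : absK Fq (polyToK Fq n) = 0 := by simp [absK, hn]
    rw [this, zero_div, if_pos (by positivity), if_pos (Or.inl hn)]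
  · rw [absK_polyToK Fq hn]
    have : ((Fintype.card Fq : ℝ) ^ n.natDegree / (Fintype.card Fq : ℝ) ^ (2 * Q) <
        (Fintype.card Fq : ℝ) ^ r.natDegree / (Fintype.card Fq : ℝ) ^ Q) ↔
        n = 0 ∨ n.natDegree < r.natDegree + Q := by
      rw [two_mul, pow_add, ← div_div, div_lt_div_iff_of_pos_right (by positivity),
        div_lt_iff₀ (by positivity), ← pow_add, pow_lt_pow_iff_right₀ hq]
      simp [hn]
    simp only [this]

/-! ### Characters on balls -/

/-- The ball `{α : |α| < q^{-m}}` of `K_∞`, described by coefficients. -/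
def ballK (m : ℕ) : Set (Kinf Fq) := {x | ∀ i : ℤ, i ≤ m → x.coeff i = 0}

lemma absK_lt_zpow_iff (m : ℕ) (x : Kinf Fq) :
    absK Fq x < (Fintype.card Fq : ℝ) ^ (-(m : ℤ)) ↔ x ∈ ballK Fq m := by
  have hq := one_lt_card_real Fq
  by_cases hx : x = 0
  · have : (0 : ℝ) < (Fintype.card Fq : ℝ) ^ (-(m : ℤ)) := zpow_pos (by linarith) _
    simpa [hx, absK, ballK] using this
  · rw [absK, if_neg hx, zpow_lt_zpow_iff_right₀ hq, neg_lt_neg_iff]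
    refine ⟨fun h i hi => HahnSeries.coeff_eq_zero_of_lt_order (by omega), fun h => ?_⟩
    by_contra! hlt
    exact hx (HahnSeries.coeff_order_eq_zero.1 (h _ hlt))

lemma setOf_absK_lt {r : Polynomial Fq} (hr : r ≠ 0) (Q : ℕ) :
    {α : Kinf Fq | absK Fq α < (absK Fq (polyToK Fq r))⁻¹ * (Fintype.card Fq : ℝ) ^ (-(Q : ℤ))} =
      ballK Fq (r.natDegree + Q) := by
  ext x
  rw [Set.mem_ofPred_eq, ← absK_lt_zpow_iff, absK_polyToK Fq hr, zpow_neg, zpow_neg,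
    zpow_natCast, zpow_natCast, pow_add, mul_inv]

lemma measurableSet_sub_mem_ballK (m : ℕ) (a : Kinf Fq) :
    @MeasurableSet _ (KinfMS Fq) {x | x - a ∈ ballK Fq m} := by
  refine MeasurableSpace.measurableSet_generateFrom ⟨a, -(m : ℤ), ?_⟩
  ext x
  exact (absK_lt_zpow_iff Fq m _).symm

lemma measurableSet_ballK (m : ℕ) : @MeasurableSet _ (KinfMS Fq) (ballK Fq m) := by
  simpa using measurableSet_sub_mem_ballK Fq m 0

lemma measurable_add_left_kinf (a : Kinf Fq) :
    @Measurable _ _ (KinfMS Fq) (KinfMS Fq) (a + ·) := by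
  refine @measurable_generateFrom _ _ (KinfMS Fq) _ _ ?_
  rintro s ⟨b, k, rfl⟩
  refine MeasurableSpace.measurableSet_generateFrom ⟨b - a, k, ?_⟩
  ext x
  simp [sub_sub_eq_add_sub, add_comm]

lemma add_mem_ballK_iff {m : ℕ} {a : Kinf Fq} (ha : a ∈ ballK Fq m) (x : Kinf Fq) :
    a + x ∈ ballK Fq m ↔ x ∈ ballK Fq m := by
  refine forall₂_congr fun i hi => ?_
  rw [HahnSeries.coeff_add, ha i hi, zero_add]

section Measure

variable {Fq} {μ : @Measure (Kinf Fq) (KinfMS Fq)}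

lemma IsHaar.measure_ballK_succ (hμ : IsHaar Fq μ) (m : ℕ) :
    μ (ballK Fq m) = Fintype.card Fq * μ (ballK Fq (m + 1)) := by
  let _ := KinfMS Fq
  have hU : ballK Fq m =
      ⋃ c : Fq, {x | x - HahnSeries.single ((m : ℤ) + 1) c ∈ ballK Fq (m + 1)} := by
    ext x
    simp only [Set.mem_iUnion, Set.mem_ofPred_eq]
    constructor
    · intro hx
      refine ⟨x.coeff (m + 1), fun i hi => ?_⟩
      rw [HahnSeries.coeff_sub, HahnSeries.coeff_single]
      split_ifs with h
      · rw [h, sub_self]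
      · push_cast at hi
        rw [hx i (by omega), sub_zero]
    · rintro ⟨c, hc⟩ i hi
      have := hc i (by push_cast; omega)
      rwa [HahnSeries.coeff_sub, HahnSeries.coeff_single, if_neg (by omega), sub_zero] at this
  rw [hU, measure_iUnion]
  · have (c : Fq) : μ {x | x - HahnSeries.single ((m : ℤ) + 1) c ∈ ballK Fq (m + 1)} =
        μ (ballK Fq (m + 1)) := by
      rw [← hμ.1 (-HahnSeries.single ((m : ℤ) + 1) c) (ballK Fq (m + 1))]
      congr 1
      ext x
      simp [neg_add_eq_sub]
    simp [this, tsum_fintype]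
  · intro c d hcd
    refine Set.disjoint_left.2 fun x hc hd => hcd ?_
    have h1 := hc (m + 1) (by push_cast; rfl)
    have h2 := hd (m + 1) (by push_cast; rfl)
    rw [HahnSeries.coeff_sub, HahnSeries.coeff_single_same, sub_eq_zero] at h1 h2
    rw [← h1, ← h2]
  · exact fun c => measurableSet_sub_mem_ballK Fq (m + 1) _

lemma IsHaar.measureReal_ballK (hμ : IsHaar Fq μ) (m : ℕ) :
    (μ (ballK Fq m)).toReal = ((Fintype.card Fq : ℝ) ^ m)⁻¹ := by
  induction m with
  | zero =>
    have : {x : Kinf Fq | absK Fq x < 1} = ballK Fq 0 := by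
      ext x
      simpa using absK_lt_zpow_iff Fq 0 x
    rw [← this, hμ.2]
    simp
  | succ m ih =>
    have hq : (Fintype.card Fq : ℝ) ≠ 0 := by simp
    rw [hμ.measure_ballK_succ, ENNReal.toReal_mul, ENNReal.toReal_natCast] at ih
    rw [pow_succ, mul_inv, ← ih]
    field_simp

lemma IsHaar.setIntegral_add_left (hμ : IsHaar Fq μ) {m : ℕ} {a : Kinf Fq} (ha : a ∈ ballK Fq m)
    (f : Kinf Fq → ℂ) :
    letI := KinfMS Fq
    ∫ x in ballK Fq m, f (a + x) ∂μ = ∫ x in ballK Fq m, f x ∂μ := by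
  let _ := KinfMS Fq
  let e : Kinf Fq ≃ᵐ Kinf Fq :=
    { toEquiv := Equiv.addLeft a
      measurable_toFun := measurable_add_left_kinf Fq a
      measurable_invFun := measurable_add_left_kinf Fq (-a) }
  have hmp : MeasurePreserving e μ μ := by
    refine ⟨e.measurable, Measure.ext fun s hs => ?_⟩
    rw [Measure.map_apply e.measurable hs]
    exact hμ.1 a s
  have hpre : e ⁻¹' ballK Fq m = ballK Fq m := Set.ext fun x => add_mem_ballK_iff Fq ha x
  have := hmp.setIntegral_preimage_emb e.measurableEmbedding f (ballK Fq m)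
  rwa [hpre] at this

lemma IsHaar.setIntegral_psiK (hμ : IsHaar Fq μ) (m : ℕ) (n : Polynomial Fq) :
    letI := KinfMS Fq
    ∫ x in ballK Fq m, psiK Fq (x * polyToK Fq n) ∂μ =
      (((if n = 0 ∨ n.natDegree < m then ((Fintype.card Fq : ℝ) ^ m)⁻¹ else 0) : ℝ) : ℂ) := by
  let _ := KinfMS Fq
  split_ifs with h
  · have hone : ∀ x ∈ ballK Fq m, psiK Fq (x * polyToK Fq n) = 1 := by
      intro x hx
      suffices (x * polyToK Fq n).coeff 1 = 0 by rw [psiK, this, eFq_zero]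
      by_cases hxn : x * polyToK Fq n = 0
      · simp [hxn]
      have hx0 := left_ne_zero_of_mul hxn
      have hn0 : n ≠ 0 := by
        rintro rfl
        simp at hxn
      refine HahnSeries.coeff_eq_zero_of_lt_order ?_
      rw [HahnSeries.order_mul hx0 (right_ne_zero_of_mul hxn), order_polyToK Fq hn0]
      have : (m : ℤ) + 1 ≤ x.order :=
        (HahnSeries.le_order_iff_forall hx0).2 fun j hj => hx j (by omega)
      have := h.resolve_left hn0
      omega
    rw [setIntegral_congr_fun (measurableSet_ballK Fq m) hone]
    simp [Measure.real, hμ.measureReal_ballK]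
  · push Not at h
    obtain ⟨hn, hm⟩ := h
    obtain ⟨c, hc⟩ := exists_psiK_single_mul_ne_one Fq (x := polyToK Fq n)
      (i := (n.natDegree : ℤ) + 1) (by
        rw [coeff_polyToK, if_pos (by omega)]
        simpa using hn)
    have ha : HahnSeries.single ((n.natDegree : ℤ) + 1) c ∈ ballK Fq m := fun i hi => by
      rw [HahnSeries.coeff_single, if_neg (by omega)]
    have key := hμ.setIntegral_add_left ha fun x => psiK Fq (x * polyToK Fq n)
    simp only [add_mul, psiK_add, integral_const_mul] at key
    simpa using (mul_left_eq_self₀.1 key).resolve_left hc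

end Measure

/-! ### Sums over polynomials -/

variable {Fq} in
lemma mem_polysLT {d : ℕ} {p : Polynomial Fq} : p ∈ polysLT Fq d ↔ p.degree < d := by
  simp only [polysLT, Finset.mem_image, Finset.mem_univ, true_and]
  constructor
  · rintro ⟨c, rfl⟩
    exact degree_sum_fin_lt c
  · intro h
    refine ⟨fun i => p.coeff i, ?_⟩
    rw [Fin.sum_univ_eq_sum_range (fun i => C (p.coeff i) * X ^ i) d]
    by_cases hp : p = 0
    · simp [hp]
    · exact (as_sum_range_C_mul_X_pow' p ((natDegree_lt_iff_degree_lt hp).2 h)).symm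

lemma card_polysLT (d : ℕ) : (polysLT Fq d).card = Fintype.card Fq ^ d := by
  rw [polysLT, Finset.card_image_of_injective]
  · simp
  · intro c c' h
    ext i
    have := congrArg (fun p => p.coeff (i : ℕ)) h
    simpa [finsetSum_coeff, coeff_X_pow, Fin.val_inj] using this

/-- The monic polynomials of degree `d`. -/
def monicsOfDegree (d : ℕ) : Finset (Polynomial Fq) :=
  (polysLT Fq (d + 1)).filter fun r => r.Monic ∧ r.natDegree = d

variable {Fq} in
lemma mem_monicsOfDegree {d : ℕ} {r : Polynomial Fq} :
    r ∈ monicsOfDegree Fq d ↔ r.Monic ∧ r.natDegree = d := by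
  simp only [monicsOfDegree, Finset.mem_filter, mem_polysLT, and_iff_right_iff_imp]
  rintro ⟨hr, rfl⟩
  rw [degree_eq_natDegree hr.ne_zero]
  exact_mod_cast Nat.lt_succ_self _

lemma card_monicsOfDegree (d : ℕ) : (monicsOfDegree Fq d).card = Fintype.card Fq ^ d := by
  rw [← card_polysLT]
  refine (Finset.card_nbij (X ^ d + ·) ?_ (add_right_injective _).injOn ?_).symm
  · intro p hp
    have hp' := mem_polysLT.1 hp
    exact mem_monicsOfDegree.2 ⟨monic_X_pow_add hp', by
      rw [natDegree_add_eq_left_of_degree_lt (by simpa using hp'), natDegree_X_pow]⟩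
  · intro r hr
    obtain ⟨hm, rfl⟩ := mem_monicsOfDegree.1 (Finset.mem_coe.1 hr)
    refine ⟨r - X ^ r.natDegree, mem_polysLT.2 ?_, by simp⟩
    rw [← degree_eq_natDegree hm.ne_zero]
    exact degree_sub_lt_left (by simp [degree_eq_natDegree hm.ne_zero]) hm.ne_zero (by simp [hm])

lemma filter_monic_polysLT (Q : ℕ) :
    (polysLT Fq (Q + 1)).filter (fun r => r.Monic) =
      (Finset.range (Q + 1)).biUnion (monicsOfDegree Fq) := by
  ext r
  simp only [Finset.mem_filter, mem_polysLT, Finset.mem_biUnion, Finset.mem_range,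
    mem_monicsOfDegree]
  constructor
  · rintro ⟨h, hr⟩
    exact ⟨_, (natDegree_lt_iff_degree_lt hr.ne_zero).2 h, hr, rfl⟩
  · rintro ⟨d, hd, hr, rfl⟩
    exact ⟨(natDegree_lt_iff_degree_lt hr.ne_zero).1 hd, hr⟩

lemma sum_filter_monic_polysLT (Q : ℕ) (f : Polynomial Fq → ℂ) :
    ∑ r ∈ (polysLT Fq (Q + 1)).filter (fun r => r.Monic), f r =
      ∑ d ∈ Finset.range (Q + 1), ∑ r ∈ monicsOfDegree Fq d, f r := by
  rw [filter_monic_polysLT, Finset.sum_biUnion]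
  intro d _ e _ hde
  refine Finset.disjoint_left.2 fun r hd he => hde ?_
  rw [← (mem_monicsOfDegree.1 hd).2, ← (mem_monicsOfDegree.1 he).2]

lemma psiK_mul_div_of_dvd {r n : Polynomial Fq} (hr : r ≠ 0) (h : r ∣ n) (a : Polynomial Fq) :
    psiK Fq (polyToK Fq (a * n) / polyToK Fq r) = 1 := by
  obtain ⟨m, rfl⟩ := h
  rw [mul_left_comm, map_mul, mul_div_cancel_left₀ _ (polyToK_ne_zero Fq hr), psiK_polyToK]

lemma exists_psiK_mul_div_ne_one {r n : Polynomial Fq} (hr : r ≠ 0) (h : ¬ r ∣ n) :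
    ∃ a ∈ polysLT Fq r.natDegree, psiK Fq (polyToK Fq (a * n) / polyToK Fq r) ≠ 1 := by
  set s := n % r
  have hs : s ≠ 0 := fun hs => h ((EuclideanDomain.mod_eq_zero).1 hs)
  have hsr : s.natDegree < r.natDegree := natDegree_lt_natDegree hs (degree_mod_lt n hr)
  have hrK := polyToK_ne_zero Fq hr
  set y := polyToK Fq s / polyToK Fq r with hy
  have hy0 : y ≠ 0 := div_ne_zero (polyToK_ne_zero Fq hs) hrK
  have hord : y.order = (r.natDegree : ℤ) - s.natDegree := by
    have := HahnSeries.order_mul hy0 hrK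
    rw [hy, div_mul_cancel₀ _ hrK, ← hy, order_polyToK Fq hs, order_polyToK Fq hr] at this
    omega
  obtain ⟨c, hc⟩ := exists_psiK_single_mul_ne_one Fq (x := y)
    (i := -((r.natDegree - s.natDegree - 1 : ℕ) : ℤ)) (by
      have : (1 : ℤ) - -((r.natDegree - s.natDegree - 1 : ℕ) : ℤ) = y.order := by omega
      rwa [this, Ne, HahnSeries.coeff_order_eq_zero])
  refine ⟨C c * X ^ (r.natDegree - s.natDegree - 1), mem_polysLT.2 ?_, ?_⟩
  · refine (degree_C_mul_X_pow_le _ _).trans_lt ?_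
    exact_mod_cast (by omega : r.natDegree - s.natDegree - 1 < r.natDegree)
  · rw [← polyToK_C_mul_X_pow] at hc
    have hn : n = r * (n / r) + s := (EuclideanDomain.div_add_mod n r).symm
    rwa [hn, mul_add, map_add, add_div, psiK_add,
      psiK_mul_div_of_dvd Fq hr (dvd_mul_right r _), one_mul, map_mul _ _ s, mul_div_assoc]

lemma sum_psiK_mul_div {r : Polynomial Fq} (hr : r ≠ 0) (n : Polynomial Fq) :
    ∑ a ∈ polysLT Fq r.natDegree, psiK Fq (polyToK Fq (a * n) / polyToK Fq r) =
      if r ∣ n then (Fintype.card Fq : ℂ) ^ r.natDegree else 0 := by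
  split_ifs with h
  · simp only [psiK_mul_div_of_dvd Fq hr h]
    simp [card_polysLT]
  · obtain ⟨b, hb, hψ⟩ := exists_psiK_mul_div_ne_one Fq hr h
    have hb' := mem_polysLT.1 hb
    have key : ∑ a ∈ polysLT Fq r.natDegree, psiK Fq (polyToK Fq ((b + a) * n) / polyToK Fq r) =
        ∑ a ∈ polysLT Fq r.natDegree, psiK Fq (polyToK Fq (a * n) / polyToK Fq r) := by
      refine Finset.sum_nbij' (b + ·) (· - b) (fun a ha => ?_) (fun a ha => ?_) (by simp) (by simp)
        (fun _ _ => rfl)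
      · exact mem_polysLT.2 ((degree_add_le _ _).trans_lt (max_lt hb' (mem_polysLT.1 ha)))
      · exact mem_polysLT.2 ((degree_sub_le _ _).trans_lt (max_lt (mem_polysLT.1 ha) hb'))
    simp only [add_mul, map_add, add_div, psiK_add, ← Finset.mul_sum] at key
    exact (mul_left_eq_self₀.1 key).resolve_left hψ

/-- The sum of the Ramanujan sums `c_r(n)` over the monic `r` of degree `k`. -/
def ramanujanSum (k : ℕ) (n : Polynomial Fq) : ℂ :=
  ∑ r ∈ monicsOfDegree Fq k, ∑ a ∈ coprimeReps Fq r,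
    psiK Fq (polyToK Fq (a * n) / polyToK Fq r)

/-- The number of monic divisors of `n` of degree `d`. -/
def monicDivisorCount (d : ℕ) (n : Polynomial Fq) : ℕ :=
  ((monicsOfDegree Fq d).filter (· ∣ n)).card

variable {Fq} in
lemma mem_coprimeReps {r a : Polynomial Fq} :
    a ∈ coprimeReps Fq r ↔ a.degree < r.natDegree ∧ IsCoprime a r := by
  rw [coprimeReps, Finset.mem_filter, mem_polysLT]

lemma dvd_of_mul_eq_mul_of_isCoprime {g r a h s b : Polynomial Fq} (hr : g * r = h * s)
    (ha : g * a = h * b) (hbs : IsCoprime b s) : g ∣ h := by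
  obtain ⟨u, v, huv⟩ := hbs
  refine ⟨u * a + v * r, ?_⟩
  linear_combination (-h) * huv - u * ha - v * hr

lemma exists_monic_gcd {r : Polynomial Fq} (hr : r.Monic) (a : Polynomial Fq) :
    ∃ g : Polynomial Fq, g.Monic ∧ ∃ r' a' : Polynomial Fq,
      r = g * r' ∧ a = g * a' ∧ IsCoprime a' r' := by
  have hg0 : EuclideanDomain.gcd a r ≠ 0 := fun h =>
    hr.ne_zero (EuclideanDomain.gcd_eq_zero_iff.1 h).2
  set g := EuclideanDomain.gcd a r * C (EuclideanDomain.gcd a r).leadingCoeff⁻¹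
  have hg : g.Monic := monic_mul_leadingCoeff_inv hg0
  have hu : IsUnit (C (EuclideanDomain.gcd a r).leadingCoeff⁻¹) :=
    isUnit_C.2 (inv_ne_zero (leadingCoeff_ne_zero.2 hg0)).isUnit
  obtain ⟨r', hr'⟩ : g ∣ r := hu.mul_right_dvd.2 (EuclideanDomain.gcd_dvd_right a r)
  obtain ⟨a', ha'⟩ : g ∣ a := hu.mul_right_dvd.2 (EuclideanDomain.gcd_dvd_left a r)
  refine ⟨g, hg, r', a', hr', ha', ?_⟩
  obtain ⟨v, hv⟩ : EuclideanDomain.gcd a r ∣ g := Dvd.intro _ rfl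
  have hbez := EuclideanDomain.gcd_eq_gcd_ab a r
  refine ⟨EuclideanDomain.gcdA a r * v, EuclideanDomain.gcdB a r * v,
    mul_left_cancel₀ hg.ne_zero ?_⟩
  linear_combination (-v * EuclideanDomain.gcdA a r) * ha' -
    v * EuclideanDomain.gcdB a r * hr' - v * hbez - hv

/-- Every fraction `a / r` with `r` monic of degree `d` is uniquely a reduced fraction with
monic denominator. -/
lemma sum_fractions_eq (d : ℕ) (f : Kinf Fq → ℂ) :
    ∑ r ∈ monicsOfDegree Fq d, ∑ a ∈ polysLT Fq d, f (polyToK Fq a / polyToK Fq r) =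
      ∑ k ∈ Finset.range (d + 1), (Fintype.card Fq : ℂ) ^ (d - k) *
        ∑ r ∈ monicsOfDegree Fq k, ∑ a ∈ coprimeReps Fq r, f (polyToK Fq a / polyToK Fq r) := by
  have hcard (k : ℕ) (z : ℂ) : (Fintype.card Fq : ℂ) ^ (d - k) * z =
      ∑ _g ∈ monicsOfDegree Fq (d - k), z := by
    simp [card_monicsOfDegree]
  simp only [hcard]
  rw [← Finset.sum_product', Finset.sum_congr rfl fun k _ => (Finset.sum_product' _ _ _).symm]
  simp only [Finset.sum_sigma']
  symm
  refine Finset.sum_nbij (fun x => (x.2.1.1 * x.2.1.2, x.2.1.1 * x.2.2)) ?_ ?_ ?_ ?_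
  · rintro ⟨k, ⟨g, r⟩, a⟩ h
    simp only [Finset.mem_sigma, Finset.mem_product, Finset.mem_range, mem_monicsOfDegree,
      mem_coprimeReps, mem_polysLT] at h ⊢
    obtain ⟨hk, ⟨⟨hg, hgd⟩, hr, hrd⟩, ha, -⟩ := h
    refine ⟨⟨hg.mul hr, by rw [hg.natDegree_mul hr]; omega⟩, ?_⟩
    by_cases ha0 : a = 0
    · simp [ha0]
    · rw [← natDegree_lt_iff_degree_lt ha0] at ha
      rw [← natDegree_lt_iff_degree_lt (mul_ne_zero hg.ne_zero ha0),
        natDegree_mul hg.ne_zero ha0]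
      omega
  · rintro ⟨k, ⟨g, r⟩, a⟩ h ⟨l, ⟨g', r'⟩, a'⟩ h' heq
    simp only [Finset.mem_coe, Finset.mem_sigma, Finset.mem_product, Finset.mem_range,
      mem_monicsOfDegree, mem_coprimeReps] at h h'
    obtain ⟨-, ⟨⟨hg, -⟩, -, rfl⟩, -, har⟩ := h
    obtain ⟨-, ⟨⟨hg', -⟩, -, rfl⟩, -, har'⟩ := h'
    simp only [Prod.mk.injEq] at heq
    obtain ⟨h1, h2⟩ := heq
    obtain rfl : g = g' := eq_of_monic_of_associated hg hg' (associated_of_dvd_dvd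
      (dvd_of_mul_eq_mul_of_isCoprime Fq h1 h2 har')
      (dvd_of_mul_eq_mul_of_isCoprime Fq h1.symm h2.symm har))
    obtain rfl := mul_left_cancel₀ hg.ne_zero h1
    obtain rfl := mul_left_cancel₀ hg.ne_zero h2
    rfl
  · rintro ⟨r, a⟩ h
    simp only [Finset.mem_coe, Finset.mem_product, mem_monicsOfDegree, mem_polysLT] at h
    obtain ⟨⟨hr, rfl⟩, ha⟩ := h
    obtain ⟨g, hg, r', a', hr', rfl, hcop⟩ := exists_monic_gcd Fq hr a
    have hr'm : r'.Monic := hg.of_mul_monic_left (hr' ▸ hr)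
    have hdeg : r.natDegree = g.natDegree + r'.natDegree := by rw [hr', hg.natDegree_mul hr'm]
    refine ⟨⟨r'.natDegree, ⟨g, r'⟩, a'⟩, ?_, by rw [hr']⟩
    simp only [Finset.mem_coe, Finset.mem_sigma, Finset.mem_product, Finset.mem_range,
      mem_monicsOfDegree, mem_coprimeReps]
    refine ⟨by omega, ⟨⟨hg, by omega⟩, hr'm, trivial⟩, ?_, hcop⟩
    by_cases ha0 : a' = 0
    · simp [ha0]
    · rw [← natDegree_lt_iff_degree_lt (mul_ne_zero hg.ne_zero ha0),
        natDegree_mul hg.ne_zero ha0] at ha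
      rw [← natDegree_lt_iff_degree_lt ha0]
      omega
  · rintro ⟨k, ⟨g, r⟩, a⟩ h
    simp only [Finset.mem_sigma, Finset.mem_product, mem_monicsOfDegree] at h
    simp only [map_mul]
    rw [mul_div_mul_left _ _ (polyToK_ne_zero Fq h.2.1.1.1.ne_zero)]

lemma pow_mul_monicDivisorCount (d : ℕ) (n : Polynomial Fq) :
    (Fintype.card Fq : ℂ) ^ d * monicDivisorCount Fq d n =
      ∑ k ∈ Finset.range (d + 1), (Fintype.card Fq : ℂ) ^ (d - k) * ramanujanSum Fq k n := by
  have h := sum_fractions_eq Fq d fun x => psiK Fq (x * polyToK Fq n)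
  simp only [div_mul_eq_mul_div, ← map_mul] at h
  simp only [ramanujanSum]
  rw [← h, monicDivisorCount, Finset.card_filter, Nat.cast_sum, Finset.mul_sum]
  refine Finset.sum_congr rfl fun r hr => ?_
  obtain ⟨hm, rfl⟩ := mem_monicsOfDegree.1 hr
  rw [sum_psiK_mul_div Fq hm.ne_zero]
  simp

lemma monicDivisorCount_eq_sum (d : ℕ) (n : Polynomial Fq) :
    (monicDivisorCount Fq d n : ℂ) =
      ∑ k ∈ Finset.range (d + 1), ramanujanSum Fq k n / (Fintype.card Fq : ℂ) ^ k := by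
  have hq : (Fintype.card Fq : ℂ) ≠ 0 := by simp
  rw [← mul_right_inj' (pow_ne_zero d hq), pow_mul_monicDivisorCount, Finset.mul_sum]
  refine Finset.sum_congr rfl fun k hk => ?_
  rw [pow_sub₀ _ hq (Finset.mem_range_succ_iff.1 hk)]
  ring

lemma monicDivisorCount_zero_right (d : ℕ) :
    monicDivisorCount Fq d 0 = Fintype.card Fq ^ d := by
  simp [monicDivisorCount, card_monicsOfDegree]

lemma monicDivisorCount_eq_zero {d : ℕ} {n : Polynomial Fq} (hn : n ≠ 0) (h : n.natDegree < d) :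
    monicDivisorCount Fq d n = 0 := by
  rw [monicDivisorCount, Finset.card_eq_zero, Finset.filter_eq_empty_iff]
  intro r hr hdvd
  have := natDegree_le_of_dvd hdvd hn
  rw [(mem_monicsOfDegree.1 hr).2] at this
  omega

lemma monicDivisorCount_le_complement {d e : ℕ} {n : Polynomial Fq} (hn : n ≠ 0)
    (h : d + e = n.natDegree) : monicDivisorCount Fq d n ≤ monicDivisorCount Fq e n := by
  have hlc : n.leadingCoeff⁻¹ ≠ 0 := by simpa using hn
  have hC : C n.leadingCoeff⁻¹ ≠ 0 := by simpa using hn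
  have hu : IsUnit (C n.leadingCoeff⁻¹) := isUnit_C.2 hlc.isUnit
  set m := n * C n.leadingCoeff⁻¹ with hm
  have hmm : m.Monic := monic_mul_leadingCoeff_inv hn
  have hdeg : m.natDegree = n.natDegree := natDegree_mul_C hlc
  have hdvd (r : Polynomial Fq) : r ∣ n ↔ r ∣ m := (hu.dvd_mul_right).symm
  simp only [monicDivisorCount, hdvd]
  have hdiv (r : Polynomial Fq) (hr : r ∣ m) : r * (m / r) = m :=
    EuclideanDomain.mul_div_cancel' (ne_zero_of_dvd_ne_zero hmm.ne_zero hr) hr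
  refine Finset.card_le_card_of_injOn (fun r => m / r) (fun r hr => ?_) fun r hr s hs hrs => ?_
  · simp only [Finset.mem_coe, Finset.mem_filter, mem_monicsOfDegree] at hr ⊢
    obtain ⟨⟨hr, hrd⟩, hrm⟩ := hr
    have := hdiv r hrm
    have hmon : (m / r).Monic := hr.of_mul_monic_left (this.symm ▸ hmm)
    refine ⟨⟨hmon, ?_⟩, Dvd.intro_left _ this⟩
    have h2 := hr.natDegree_mul hmon
    rw [this] at h2
    omega
  · simp only [Finset.mem_coe, Finset.mem_filter] at hr hs hrs
    have h1 := hdiv r hr.2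
    have h2 := hdiv s hs.2
    have h0 : m / r ≠ 0 := right_ne_zero_of_mul (h1.symm ▸ hmm.ne_zero)
    refine mul_right_cancel₀ h0 ?_
    rw [h1, hrs, h2]

lemma monicDivisorCount_complement {d e : ℕ} {n : Polynomial Fq} (hn : n ≠ 0)
    (h : d + e = n.natDegree) : monicDivisorCount Fq d n = monicDivisorCount Fq e n :=
  (monicDivisorCount_le_complement Fq hn h).antisymm
    (monicDivisorCount_le_complement Fq hn (by omega))

lemma sum_ramanujanSum_eq (Q : ℕ) (n : Polynomial Fq) :
    ∑ k ∈ Finset.range (Q + 1), (if n = 0 ∨ n.natDegree < k + Q then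
        ramanujanSum Fq k n / (Fintype.card Fq : ℂ) ^ k else 0) =
      if n = 0 then (Fintype.card Fq : ℂ) ^ Q else 0 := by
  by_cases hn : n = 0
  · simp only [hn, true_or, if_true]
    rw [← monicDivisorCount_eq_sum, monicDivisorCount_zero_right]
    simp
  simp only [hn, false_or, if_false]
  rcases lt_or_ge n.natDegree Q with hlt | hge
  · rw [Finset.sum_congr rfl fun k _ => if_pos (by omega), ← monicDivisorCount_eq_sum,
      monicDivisorCount_eq_zero Fq hn hlt, Nat.cast_zero]
  obtain ⟨e, he⟩ := Nat.exists_eq_add_of_le hge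
  rcases lt_or_ge e (Q + 1) with hlt | hgt
  · have hsplit := Finset.sum_range_add_sum_Ico
      (fun k => ramanujanSum Fq k n / (Fintype.card Fq : ℂ) ^ k) (show e + 1 ≤ Q + 1 by omega)
    rw [← monicDivisorCount_eq_sum, ← monicDivisorCount_eq_sum,
      monicDivisorCount_complement Fq hn he.symm, add_eq_left] at hsplit
    rw [← Finset.sum_filter]
    refine Eq.trans ?_ hsplit
    refine Finset.sum_congr (Finset.ext fun k => ?_) fun _ _ => rfl
    simp only [Finset.mem_filter, Finset.mem_range, Finset.mem_Ico]
    omega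
  · refine Finset.sum_eq_zero fun k hk => if_neg ?_
    have := Finset.mem_range.1 hk
    omega

/-- **Expansion of the delta function (function-field delta method).** For `Q ≥ 1` and
`n ∈ 𝔽_q[t]`,
`δ(n) = q^{−2Q} ∑_{r monic, |r| ≤ q^Q} ∑*_{|a|<|r|} ψ(an/r)·h(r/t^Q, n/t^{2Q})`, and moreover
`q^{−2Q}·h(r/t^Q, n/t^{2Q}) = ∫_{|α| < |r|^{−1} q^{−Q}} ψ(αn) dμ` for each such `r`. -/
theorem stmt_16 (μ : @MeasureTheory.Measure (Kinf Fq) (KinfMS Fq)) (hμ : IsHaar Fq μ)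
    (Q : ℕ) (hQ : 1 ≤ Q) (n : Polynomial Fq) :
    ((if n = 0 then 1 else 0 : ℂ) =
      ((Fintype.card Fq : ℂ) ^ (2 * Q))⁻¹ *
        ∑ r ∈ (polysLT Fq (Q + 1)).filter fun r => r.Monic,
          ∑ a ∈ coprimeReps Fq r,
            psiK Fq (polyToK Fq (a * n) / polyToK Fq r) *
              ((hwt Fq (polyToK Fq r / tK Fq ^ Q) (polyToK Fq n / tK Fq ^ (2 * Q)) : ℝ) : ℂ)) ∧
    ∀ r : Polynomial Fq, r.Monic → r.natDegree ≤ Q →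
      (((((Fintype.card Fq : ℝ) ^ (2 * Q))⁻¹ *
          hwt Fq (polyToK Fq r / tK Fq ^ Q) (polyToK Fq n / tK Fq ^ (2 * Q)) : ℝ)) : ℂ) =
        (letI := KinfMS Fq
          ∫ α in {α : Kinf Fq |
              absK Fq α < (absK Fq (polyToK Fq r))⁻¹ * (Fintype.card Fq : ℝ) ^ (-(Q : ℤ))},
            psiK Fq (α * polyToK Fq n) ∂μ) := by
  refine ⟨?_, fun r hr hrQ => ?_⟩
  · have hq : (Fintype.card Fq : ℂ) ≠ 0 := by simp
    have hterm : ∀ k ∈ Finset.range (Q + 1), ∑ r ∈ monicsOfDegree Fq k,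
        ∑ a ∈ coprimeReps Fq r, psiK Fq (polyToK Fq (a * n) / polyToK Fq r) *
          ((hwt Fq (polyToK Fq r / tK Fq ^ Q) (polyToK Fq n / tK Fq ^ (2 * Q)) : ℝ) : ℂ) =
        (Fintype.card Fq : ℂ) ^ Q * if n = 0 ∨ n.natDegree < k + Q then
          ramanujanSum Fq k n / (Fintype.card Fq : ℂ) ^ k else 0 := by
      intro k _
      have hr : ∀ r ∈ monicsOfDegree Fq k, ∑ a ∈ coprimeReps Fq r,
          psiK Fq (polyToK Fq (a * n) / polyToK Fq r) *
            ((hwt Fq (polyToK Fq r / tK Fq ^ Q) (polyToK Fq n / tK Fq ^ (2 * Q)) : ℝ) : ℂ) =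
          (∑ a ∈ coprimeReps Fq r, psiK Fq (polyToK Fq (a * n) / polyToK Fq r)) *
            if n = 0 ∨ n.natDegree < k + Q then
              (Fintype.card Fq : ℂ) ^ Q / (Fintype.card Fq : ℂ) ^ k else 0 := by
        intro r hr
        obtain ⟨hm, rfl⟩ := mem_monicsOfDegree.1 hr
        rw [hwt_eq Fq hm.ne_zero, Finset.sum_mul]
        split_ifs <;> simp
      rw [Finset.sum_congr rfl hr, ← Finset.sum_mul, ← ramanujanSum]
      split_ifs
      · ring
      · simp
    rw [sum_filter_monic_polysLT, Finset.sum_congr rfl hterm, ← Finset.mul_sum,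
      sum_ramanujanSum_eq]
    split_ifs
    · rw [two_mul, ← pow_add, inv_mul_cancel₀ (pow_ne_zero _ hq)]
    · simp
  · rw [setOf_absK_lt Fq hr.ne_zero, hμ.setIntegral_psiK, hwt_eq Fq hr.ne_zero]
    have hq : (Fintype.card Fq : ℝ) ≠ 0 := by simp
    congr 1
    split_ifs
    · rw [two_mul, pow_add, pow_add]
      field_simp
    · simp


end
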